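/- arXiv:2012.02656 — 2 statements merged into one kernel-verified Lean document; each statement's English description precedes it below -/
import Mathlib

section
/- Let u ∈ C^∞(Ω̄) be a convex solution of det D²u = (−u)^m in a bounded convex domain Ω ⊂ ℝⁿ₊, u = 0 on ∂Ω, with 0 ∈ ∂Ω, x_n = 0 a supporting plane of Ω at 0, ∂_n u(0) < 0, ∇_{x'}u(0) = 0, and let v be defined near 0 by u(y', v(y)) + y_n = 0 for y ∈ {y_n > 0} ∩ B_δ(0). Then v satisfies the degenerate Monge–Ampère equation det D²v = y_nᵐ (∂_n v)^{n+2} in B_δ⁺(0), and v(y',0) = φ(y'), where y_n = φ(y') is the local representation of ∂Ω near 0. -/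
noncomputable section
open MeasureTheory Finset

/-- Partial derivative in direction `i`. -/
def pd {d : ℕ} (i : Fin d) (f : (Fin d → ℝ) → ℝ) : (Fin d → ℝ) → ℝ :=
  fun x => fderiv ℝ f x (Pi.single i 1)

/-- Replacing the last coordinate of `y` by `t` adds a multiple of the last basis vector. -/
theorem snoc_castSucc_eq_add_smul {n : ℕ} (y : Fin (n+1) → ℝ) (t : ℝ) :
    (Fin.snoc (fun i => y (Fin.castSucc i)) t : Fin (n+1) → ℝ)
      = y + (t - y (Fin.last n)) • Pi.single (Fin.last n) 1 := by
  ext k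
  refine Fin.lastCases ?_ (fun i => ?_) k
  · simp
  · simp [(Fin.castSucc_lt_last i).ne]

theorem differentiable_pd {d : ℕ} {f : (Fin d → ℝ) → ℝ} (hf : ContDiff ℝ (⊤:ℕ∞) f)
    (i : Fin d) : Differentiable ℝ (pd i f) := by
  have h : ContDiff ℝ 1 (fderiv ℝ f) := hf.fderiv_right (by norm_cast)
  exact (h.clm_apply contDiff_const).differentiable one_ne_zero

theorem differentiableAt_pd {d : ℕ} {f : (Fin d → ℝ) → ℝ} {s : Set (Fin d → ℝ)}
    (hs : IsOpen s) (hf : ContDiffOn ℝ (⊤:ℕ∞) f s) (i : Fin d) {x : Fin d → ℝ} (hx : x ∈ s) :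
    DifferentiableAt ℝ (pd i f) x := by
  have h : ContDiffOn ℝ 1 (fderiv ℝ f) s := hf.fderiv_of_isOpen hs (by norm_cast)
  exact ((h.clm_apply contDiffOn_const).differentiableOn one_ne_zero).differentiableAt
    (hs.mem_nhds hx)

/-- The derivative of the graph map `y ↦ (y', v y)`. -/
theorem hasFDerivAt_graph {n : ℕ} {v : (Fin (n+1) → ℝ) → ℝ} {y : Fin (n+1) → ℝ}
    (hv : DifferentiableAt ℝ v y) :
    HasFDerivAt (fun y : Fin (n+1) → ℝ =>
        (Fin.snoc (fun i => y (Fin.castSucc i)) (v y) : Fin (n+1) → ℝ))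
      (ContinuousLinearMap.id ℝ _ + (fderiv ℝ v y -
        ContinuousLinearMap.proj (R := ℝ) (φ := fun _ : Fin (n+1) => ℝ) (Fin.last n)).smulRight
          (Pi.single (Fin.last n) (1:ℝ))) y := by
  simp only [snoc_castSucc_eq_add_smul]
  exact (hasFDerivAt_id y).add
    ((hv.hasFDerivAt.sub (hasFDerivAt_apply (Fin.last n) y)).smul_const _)

/-- Chain rule for the partial derivatives of a function composed with the graph map. -/
theorem pd_comp_graph {n : ℕ} {f v : (Fin (n+1) → ℝ) → ℝ} {y : Fin (n+1) → ℝ}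
    (hf : Differentiable ℝ f) (hv : DifferentiableAt ℝ v y) (i : Fin (n+1)) :
    pd i (fun y => f (Fin.snoc (fun i => y (Fin.castSucc i)) (v y))) y
      = pd i f (Fin.snoc (fun i => y (Fin.castSucc i)) (v y))
        + (pd i v y - (Pi.single i 1 : Fin (n+1) → ℝ) (Fin.last n))
          * pd (Fin.last n) f (Fin.snoc (fun i => y (Fin.castSucc i)) (v y)) := by
  have h := ((hf _).hasFDerivAt.comp y (hasFDerivAt_graph hv)).fderiv
  simp only [pd]
  rw [show (fun y : Fin (n+1) → ℝ => f (Fin.snoc (fun i => y (Fin.castSucc i)) (v y)))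
    = f ∘ fun y => Fin.snoc (fun i => y (Fin.castSucc i)) (v y) from rfl, h]
  simp

theorem pd_add {d : ℕ} {f g : (Fin d → ℝ) → ℝ} {x : Fin d → ℝ}
    (hf : DifferentiableAt ℝ f x) (hg : DifferentiableAt ℝ g x) (i : Fin d) :
    pd i (fun y => f y + g y) x = pd i f x + pd i g x := by
  simp only [pd]
  rw [fderiv_fun_add hf hg]
  simp

theorem pd_mul {d : ℕ} {f g : (Fin d → ℝ) → ℝ} {x : Fin d → ℝ}
    (hf : DifferentiableAt ℝ f x) (hg : DifferentiableAt ℝ g x) (i : Fin d) :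
    pd i (fun y => f y * g y) x = f x * pd i g x + g x * pd i f x := by
  simp only [pd]
  rw [fderiv_fun_mul hf hg]
  simp

theorem pd_sub_const {d : ℕ} (f : (Fin d → ℝ) → ℝ) (c : ℝ) (x : Fin d → ℝ) (i : Fin d) :
    pd i (fun y => f y - c) x = pd i f x := by
  simp only [pd]
  rw [fderiv_sub_const]

theorem pd_apply {d : ℕ} (k i : Fin d) (x : Fin d → ℝ) :
    pd i (fun y => y k) x = (Pi.single i 1 : Fin d → ℝ) k := by
  simp only [pd]
  rw [(hasFDerivAt_apply k x).fderiv]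
  rfl

theorem pd_eq_neg_of_add_eq_zero {d : ℕ} {f g : (Fin d → ℝ) → ℝ} {s : Set (Fin d → ℝ)}
    (hs : IsOpen s) (hfg : ∀ y ∈ s, f y + g y = 0) {x : Fin d → ℝ} (hx : x ∈ s) (i : Fin d) :
    pd i f x = - pd i g x := by
  have h : f =ᶠ[nhds x] fun y => -g y := by
    filter_upwards [hs.mem_nhds hx] with y hy
    linarith [hfg y hy]
  simp only [pd]
  rw [h.fderiv_eq, fderiv_fun_neg]
  rfl

/-- If `u (y', v y) + yₙ = 0` on an open set, then `det D²v = det D²u (∂ₙv)^(d+2)` there, with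
`d = n + 1` the dimension and `D²u` evaluated at `(y', v y)`. -/
theorem det_hessian_hodograph {n : ℕ} {u v : (Fin (n+1) → ℝ) → ℝ} {s : Set (Fin (n+1) → ℝ)}
    (hs : IsOpen s) (hu : ContDiff ℝ (⊤:ℕ∞) u) (hv : ContDiffOn ℝ (⊤:ℕ∞) v s)
    (huv : ∀ y ∈ s, u (Fin.snoc (fun i => y (Fin.castSucc i)) (v y)) + y (Fin.last n) = 0)
    {y : Fin (n+1) → ℝ} (hy : y ∈ s) :
    (Matrix.of fun i j => pd i (pd j v) y).det
      = (Matrix.of fun i j =>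
          pd i (pd j u) (Fin.snoc (fun i => y (Fin.castSucc i)) (v y))).det
        * pd (Fin.last n) v y ^ (n+3) := by
  set N := Fin.last n
  have hvd : ∀ z ∈ s, DifferentiableAt ℝ v z := fun z hz =>
    (hv.differentiableOn (by simp)).differentiableAt (hs.mem_nhds hz)
  have hgraph : ∀ {f : (Fin (n+1) → ℝ) → ℝ}, Differentiable ℝ f → DifferentiableAt ℝ
      (fun y => f (Fin.snoc (fun i => y (Fin.castSucc i)) (v y))) y := fun hf =>
    (hf _).comp y (hasFDerivAt_graph (hvd y hy)).differentiableAt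
  have first : ∀ j, ∀ z ∈ s,
      (pd j u (Fin.snoc (fun i => z (Fin.castSucc i)) (v z))
        + (pd j v z - (Pi.single j 1 : Fin (n+1) → ℝ) N)
          * pd N u (Fin.snoc (fun i => z (Fin.castSucc i)) (v z)))
        + (Pi.single j 1 : Fin (n+1) → ℝ) N = 0 := by
    intro j z hz
    rw [← pd_comp_graph (hu.differentiable (by simp)) (hvd z hz) j,
      pd_eq_neg_of_add_eq_zero hs huv hz j, pd_apply, neg_add_cancel]
  set P : Fin (n+1) → ℝ := Fin.snoc (fun i => y (Fin.castSucc i)) (v y)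
  set a : Fin (n+1) → ℝ := fun j => pd j v y - (Pi.single j 1 : Fin (n+1) → ℝ) N with ha
  set H : Matrix (Fin (n+1)) (Fin (n+1)) ℝ := Matrix.of fun i j => pd i (pd j u) P with hH
  have second : ∀ i j, H i j + a i * H N j + a j * (H i N + a i * H N N)
      = -pd N u P * pd i (pd j v) y := by
    intro i j
    have h := pd_eq_neg_of_add_eq_zero hs (first j) hy i
    have hdv := differentiableAt_pd hs hv j hy
    rw [pd_add (hgraph (differentiable_pd hu j))
        ((hdv.sub_const _).fun_mul (hgraph (differentiable_pd hu N))),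
      pd_mul (hdv.sub_const _) (hgraph (differentiable_pd hu N)), pd_sub_const,
      pd_comp_graph (differentiable_pd hu j) (hvd y hy),
      pd_comp_graph (differentiable_pd hu N) (hvd y hy)] at h
    have hc : pd i (fun _ : Fin (n+1) → ℝ => (Pi.single j 1 : Fin (n+1) → ℝ) N) y = 0 := by
      simp [pd]
    rw [hc] at h
    simp only [hH, ha, Matrix.of_apply]
    linear_combination h
  have huN : -pd N u P * pd N v y = 1 := by
    have h := first N y hy
    simp only [Pi.single_eq_same] at h
    linear_combination -h
  set A : Matrix (Fin (n+1)) (Fin (n+1)) ℝ :=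
    1 + Matrix.vecMulVec a (Pi.single N 1) with hA
  have hdetA : A.det = pd N v y := by
    rw [hA, Matrix.vecMulVec_eq Unit, Matrix.det_one_add_replicateCol_mul_replicateRow]
    simp [ha]
  have hmat : A * H * A.transpose = (-pd N u P) • Matrix.of fun i j => pd i (pd j v) y := by
    ext i j
    have hAH : ∀ k, (A * H) i k = H i k + a i * H N k := fun k => by
      simp [hA, Matrix.add_mul, Matrix.vecMulVec_mul, Matrix.vecMulVec_apply]
    have hAT : (A * H * A.transpose) i j = (A * H) i j + a j * (A * H) i N := by
      simp [hA, Matrix.mul_add, Matrix.transpose_add, Matrix.transpose_vecMulVec,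
        Matrix.mul_vecMulVec, Matrix.vecMulVec_apply, mul_comm]
    rw [hAT, hAH, hAH, second i j]
    simp
  have hdet := congrArg Matrix.det hmat
  rw [Matrix.det_mul, Matrix.det_mul, Matrix.det_transpose, hdetA, Matrix.det_smul,
    Fintype.card_fin] at hdet
  have hpow : (-pd N u P) ^ (n+1) * pd N v y ^ (n+1) = 1 := by
    rw [← mul_pow, huN, one_pow]
  linear_combination (-(Matrix.of fun i j => pd i (pd j v) y).det) * hpow
    - pd N v y ^ (n+1) * hdet

/-- under the hodograph transformation at a boundary point, the solution
`u` of `det D²u = (−u)^m`, `u = 0` on `∂Ω`, transforms into a solution `v` of the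
degenerate equation `det D²v = yₙ^m (∂ₙv)^{(n+1)+2}` in the half-ball, with boundary value
`v(y',0) = φ(y')`, where `xₙ = φ(x')` represents `∂Ω` near `0`.
(Ambient dimension is `n+1`, so the exponent `n+2` of the paper reads `n+3` here.) -/
theorem hodograph_equation (n m : ℕ) (hn : 1 ≤ n) (hm : 1 ≤ m)
    (Ω : Set (Fin (n+1) → ℝ)) (hΩopen : IsOpen Ω) (hΩconv : Convex ℝ Ω)
    (hΩsub : Ω ⊆ {x | 0 < x (Fin.last n)})
    (h0 : (0 : Fin (n+1) → ℝ) ∈ frontier Ω)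
    (u : (Fin (n+1) → ℝ) → ℝ)
    (husm : ContDiff ℝ (⊤:ℕ∞) u)
    (huconv : ConvexOn ℝ Ω u) (huneg : ∀ x ∈ Ω, u x < 0)
    (heq : ∀ x ∈ Ω, (Matrix.of fun i j => pd i (pd j u) x).det = (-u x) ^ m)
    (hbc : ∀ x ∈ frontier Ω, u x = 0)
    (hun : pd (Fin.last n) u 0 < 0)
    (hgrad : ∀ i : Fin n, pd (Fin.castSucc i) u 0 = 0)
    -- the local graph representation `xₙ = φ(x')` of `∂Ω` near `0`:
    (φ : (Fin n → ℝ) → ℝ) (δ : ℝ) (hδ : 0 < δ)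
    (hrep : ∀ x ∈ frontier Ω, x ∈ Metric.ball (0 : Fin (n+1) → ℝ) δ →
        x (Fin.last n) = φ (fun i => x (Fin.castSucc i)))
    -- the hodograph function `v`:
    (v : (Fin (n+1) → ℝ) → ℝ)
    (hvsm : ContDiffOn ℝ (⊤:ℕ∞) v
        (Metric.ball (0 : Fin (n+1) → ℝ) δ ∩ {y | 0 < y (Fin.last n)}))
    (hvc : ContinuousOn v
        (Metric.ball (0 : Fin (n+1) → ℝ) δ ∩ {y | 0 ≤ y (Fin.last n)}))
    (hv0 : v 0 = 0)
    (hv : ∀ y ∈ Metric.ball (0 : Fin (n+1) → ℝ) δ, 0 ≤ y (Fin.last n) →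
        u (Fin.snoc (fun i => y (Fin.castSucc i)) (v y)) + y (Fin.last n) = 0)
    (hvin : ∀ y ∈ Metric.ball (0 : Fin (n+1) → ℝ) δ, 0 < y (Fin.last n) →
        Fin.snoc (fun i => y (Fin.castSucc i)) (v y) ∈ Ω) :
    (∀ y ∈ Metric.ball (0 : Fin (n+1) → ℝ) δ, 0 < y (Fin.last n) →
        (Matrix.of fun i j => pd i (pd j v) y).det
          = (y (Fin.last n)) ^ m * (pd (Fin.last n) v y) ^ (n+3))
    ∧ ∃ δ' > 0, δ' ≤ δ ∧ ∀ y' : Fin n → ℝ, y' ∈ Metric.ball (0 : Fin n → ℝ) δ' →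
        v (Fin.snoc y' 0) = φ y' := by
  have hopen : IsOpen (Metric.ball (0 : Fin (n+1) → ℝ) δ ∩ {y | 0 < y (Fin.last n)}) :=
    Metric.isOpen_ball.inter (isOpen_lt continuous_const (continuous_apply _))
  refine ⟨fun y hy hyn => ?_, ?_⟩
  · rw [det_hessian_hodograph hopen husm hvsm (fun z hz => hv z hz.1 hz.2.le) ⟨hy, hyn⟩,
      heq _ (hvin y hy hyn), ← eq_neg_of_add_eq_zero_right (hv y hy hyn.le)]
  · set e : (Fin n → ℝ) → ℝ → Fin (n+1) → ℝ := fun y' t => Fin.snoc y' t with he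
    have hec : Continuous fun p : (Fin n → ℝ) × ℝ => e p.1 p.2 := by
      refine continuous_pi fun k => Fin.lastCases ?_ (fun i => ?_) k
      · simpa [he] using continuous_snd
      · simpa [he, Function.comp_def] using (continuous_apply i).comp continuous_fst
    have he0 : e 0 0 = 0 := by
      ext k
      refine Fin.lastCases ?_ (fun i => ?_) k <;> simp [he]
    have hball : Metric.ball (0 : Fin (n+1) → ℝ) δ ∈ nhds 0 := Metric.ball_mem_nhds _ hδ
    have hv_lim : Filter.Tendsto v
        (nhdsWithin 0 (Metric.ball (0 : Fin (n+1) → ℝ) δ ∩ {y | 0 ≤ y (Fin.last n)}))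
        (nhds 0) := by
      simpa only [hv0] using (hvc 0 ⟨Metric.mem_ball_self hδ, by simp⟩).tendsto
    have hslice : Filter.Tendsto (fun y' => e y' 0) (nhds 0) (nhds 0) := by
      have h : Continuous fun y' => e y' 0 :=
        hec.comp (by fun_prop : Continuous fun y' => (y', (0:ℝ)))
      simpa only [he0] using h.tendsto 0
    have hin : ∀ᶠ y' in nhds (0 : Fin n → ℝ), e y' 0 ∈ Metric.ball (0 : Fin (n+1) → ℝ) δ :=
      hslice hball
    have hv_slice : Filter.Tendsto (fun y' => v (e y' 0)) (nhds 0) (nhds 0) := by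
      refine hv_lim.comp (tendsto_nhdsWithin_iff.2 ⟨hslice, ?_⟩)
      filter_upwards [hin] with y' hy'
      exact ⟨hy', by simp [he]⟩
    have hgraph : ∀ᶠ y' in nhds (0 : Fin n → ℝ),
        e y' (v (e y' 0)) ∈ Metric.ball (0 : Fin (n+1) → ℝ) δ := by
      have h : Filter.Tendsto (fun y' => e y' (v (e y' 0))) (nhds 0) (nhds (e 0 0)) :=
        (hec.tendsto (0, 0)).comp (Filter.tendsto_id.prodMk_nhds hv_slice)
      exact h (he0 ▸ hball)
    obtain ⟨r, hr, hrsub⟩ := Metric.eventually_nhds_iff_ball.1 (hin.and hgraph)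
    refine ⟨min r δ, lt_min hr hδ, min_le_right _ _, fun y' hy' => ?_⟩
    obtain ⟨hmem, hgmem⟩ := hrsub y' (Metric.ball_subset_ball (min_le_left _ _) hy')
    have hu0 : u (e y' (v (e y' 0))) = 0 := by
      simpa [he] using hv _ hmem (by simp [he])
    have happroach : Filter.Tendsto (fun t => e y' t) (nhdsWithin 0 (Set.Ioi 0))
        (nhds (e y' 0)) := by
      have h : Continuous fun t => e y' t :=
        hec.comp (by fun_prop : Continuous fun t : ℝ => (y', t))
      exact (h.tendsto 0).mono_left nhdsWithin_le_nhds
    have hpos : ∀ᶠ t in nhdsWithin (0:ℝ) (Set.Ioi 0),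
        e y' t ∈ Metric.ball (0 : Fin (n+1) → ℝ) δ ∧ 0 < t :=
      (happroach.eventually (Metric.isOpen_ball.mem_nhds hmem)).and self_mem_nhdsWithin
    have hvt : Filter.Tendsto (fun t => v (e y' t)) (nhdsWithin 0 (Set.Ioi 0))
        (nhds (v (e y' 0))) := by
      refine (hvc _ ⟨hmem, by simp [he]⟩).tendsto.comp
        (tendsto_nhdsWithin_iff.2 ⟨happroach, ?_⟩)
      filter_upwards [hpos] with t ht
      exact ⟨ht.1, by simpa [he] using ht.2.le⟩
    have hclosure : e y' (v (e y' 0)) ∈ closure Ω := by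
      refine mem_closure_of_tendsto ((hec.tendsto (y', v (e y' 0))).comp
        (tendsto_const_nhds.prodMk_nhds hvt)) ?_
      filter_upwards [hpos] with t ht
      simpa [he] using hvin (e y' t) ht.1 (by simpa [he] using ht.2)
    have hfront : e y' (v (e y' 0)) ∈ frontier Ω := by
      rw [hΩopen.frontier_eq]
      exact ⟨hclosure, fun h => (huneg _ h).ne hu0⟩
    simpa [he] using hrep _ hfront hgmem
end
end

section
/- Let v be a smooth solution of det D²v = y_nᵐ (∂_n v)^{n+2} in B_δ⁺(0) with v(y',0) = φ(y') for |y'| ≤ δ, and suppose D²_{y'}v > 0 so that the partial Legendre transformation z = T(y) given by z_i = v_i(y) (i ≤ n−1), z_n = y_n is a diffeomorphism onto Σ⁺ = T(B_δ⁺(0)) ⊂ ℝⁿ₊. Then v*(z) = y'·∇_{y'}v(y) − v(y) satisfies z_nᵐ (−∂_n v*)^{n+2} det D²_{z'}v* + ∂²_n v* = 0 in Σ⁺, and v* = φ* on ∂Σ⁺ ∩ {z_n = 0}, where φ* is the Legendre transform of φ. -/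
noncomputable section
open MeasureTheory Finset

theorem ContinuousLinearMap.apply_eq_sum_single {d : ℕ} (L : (Fin d → ℝ) →L[ℝ] ℝ)
    (w : Fin d → ℝ) : L w = ∑ k, w k * L (Pi.single k 1) := by
  conv_lhs => rw [pi_eq_sum_univ' w]
  simp [map_sum]

theorem ContDiffAt.pd {d : ℕ} {f : (Fin d → ℝ) → ℝ} {y : Fin d → ℝ}
    (hf : ContDiffAt ℝ (⊤ : ℕ∞) f y) (i : Fin d) :
    ContDiffAt ℝ (⊤ : ℕ∞) (_root_.pd i f) y :=
  (hf.fderiv_right (m := (⊤ : ℕ∞)) (by simp)).clm_apply contDiffAt_const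

/-- If `h ∘ T = G` near `y` and `T` has an invertible strict derivative at `y`, then `h` is
differentiable at `T y`. -/
theorem HasStrictFDerivAt.hasFDerivAt_of_comp_eventuallyEq {E F : Type*}
    [NormedAddCommGroup E] [NormedSpace ℝ E] [CompleteSpace E]
    [NormedAddCommGroup F] [NormedSpace ℝ F]
    {T : E → E} {T' : E ≃L[ℝ] E} {y : E} (hT : HasStrictFDerivAt T (T' : E →L[ℝ] E) y)
    {h G : E → F} {G' : E →L[ℝ] F} (hG : HasFDerivAt G G' y)
    (hhG : ∀ᶠ x in nhds y, h (T x) = G x) :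
    HasFDerivAt h (G'.comp (T'.symm : E →L[ℝ] E)) (T y) := by
  have hgy : hT.localInverse T T' y (T y) = y := hT.localInverse_apply_image
  have hg := hT.to_localInverse.hasFDerivAt
  have hG' : HasFDerivAt G G' (hT.localInverse T T' y (T y)) := by rwa [hgy]
  refine (hG'.comp (T y) hg).congr_of_eventuallyEq ?_
  have hcont := hg.continuousAt.tendsto
  rw [hgy] at hcont
  filter_upwards [hT.eventually_right_inverse, hcont.eventually hhG] with z hz hz'
  rw [hz] at hz'
  exact hz'

/-- The determinant of a matrix some combination of whose columns, with weight one on the last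
column, is supported in the last row. -/
theorem Matrix.det_eq_of_mulVec_castSucc_eq_zero {R : Type*} [CommRing R] {n : ℕ}
    (H : Matrix (Fin (n + 1)) (Fin (n + 1)) R) (w : Fin (n + 1) → R)
    (hw : w (Fin.last n) = 1) (h0 : ∀ i : Fin n, ∑ k, w k * H i.castSucc k = 0) :
    H.det = (∑ k, w k * H (Fin.last n) k) *
      (Matrix.of fun i j : Fin n => H i.castSucc j.castSucc).det := by
  have h1 := Matrix.det_updateCol_sum H (Fin.last n) w
  rw [hw, one_smul] at h1
  rw [← h1, Matrix.det_succ_column _ (Fin.last n), Fin.sum_univ_castSucc]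
  have h2 : ∀ i : Fin n, ∑ k, w k • H i.castSucc k = 0 := h0
  simp only [Matrix.updateCol_self, h2, mul_zero, zero_mul, Finset.sum_const_zero, zero_add]
  have h3 : (H.updateCol (Fin.last n) fun k => ∑ i, w i • H k i).submatrix
      (Fin.last n).succAbove (Fin.last n).succAbove
      = Matrix.of fun i j : Fin n => H i.castSucc j.castSucc := by
    ext i j
    simp [Fin.succAbove_last, (Fin.castSucc_lt_last j).ne]
  rw [h3]
  simp [← two_mul, pow_mul]

/-- The candidate for the derivative of `y ↦ (∇_{y'} v (y), yₙ)`. -/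
def partialLegendreDeriv {n : ℕ} (v : (Fin (n + 1) → ℝ) → ℝ) (y : Fin (n + 1) → ℝ) :
    (Fin (n + 1) → ℝ) →L[ℝ] (Fin (n + 1) → ℝ) :=
  ContinuousLinearMap.pi
    (Fin.snoc (α := fun _ => (Fin (n + 1) → ℝ) →L[ℝ] ℝ)
      (fun i => fderiv ℝ (pd (Fin.castSucc i) v) y) (ContinuousLinearMap.proj (Fin.last n)))

theorem partialLegendreDeriv_castSucc {n : ℕ} (v : (Fin (n + 1) → ℝ) → ℝ)
    (y w : Fin (n + 1) → ℝ) (i : Fin n) :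
    partialLegendreDeriv v y w i.castSucc = fderiv ℝ (pd (Fin.castSucc i) v) y w := by
  simp [partialLegendreDeriv]

theorem partialLegendreDeriv_last {n : ℕ} (v : (Fin (n + 1) → ℝ) → ℝ)
    (y w : Fin (n + 1) → ℝ) :
    partialLegendreDeriv v y w (Fin.last n) = w (Fin.last n) := by
  simp [partialLegendreDeriv]

theorem hasStrictFDerivAt_partialLegendre {n : ℕ} {v : (Fin (n + 1) → ℝ) → ℝ}
    {y : Fin (n + 1) → ℝ} (hv : ContDiffAt ℝ (⊤ : ℕ∞) v y)
    {T : (Fin (n + 1) → ℝ) → (Fin (n + 1) → ℝ)}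
    (hT : ∀ y, T y = Fin.snoc (fun i => pd (Fin.castSucc i) v y) (y (Fin.last n))) :
    HasStrictFDerivAt T (partialLegendreDeriv v y) y := by
  refine hasStrictFDerivAt_pi.2 fun i => ?_
  refine Fin.lastCases ?_ (fun i => ?_) i
  · simpa [hT, partialLegendreDeriv] using
      hasStrictFDerivAt_apply (𝕜 := ℝ) (F' := fun _ : Fin (n + 1) => ℝ) (Fin.last n) y
  · simpa [hT, partialLegendreDeriv] using
      (hv.pd (Fin.castSucc i)).hasStrictFDerivAt (by simp)

theorem partialLegendreDeriv_injective {n : ℕ} {v : (Fin (n + 1) → ℝ) → ℝ}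
    {y : Fin (n + 1) → ℝ}
    (hpos : ∀ ξ : Fin n → ℝ, ξ ≠ 0 → 0 < ∑ i : Fin n, ∑ j : Fin n,
      pd (Fin.castSucc i) (pd (Fin.castSucc j) v) y * ξ i * ξ j) :
    Function.Injective (partialLegendreDeriv v y) := by
  refine (injective_iff_map_eq_zero _).2 fun w hw => ?_
  have hlast : w (Fin.last n) = 0 := by
    rw [← partialLegendreDeriv_last v y w, hw, Pi.zero_apply]
  have hcomp : ∀ j : Fin n,
      ∑ i : Fin n, w i.castSucc * pd (Fin.castSucc i) (pd (Fin.castSucc j) v) y = 0 := by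
    intro j
    have h := partialLegendreDeriv_castSucc v y w j
    rw [hw, ContinuousLinearMap.apply_eq_sum_single, Fin.sum_univ_castSucc, hlast] at h
    simpa [pd] using h.symm
  have hinit : (fun i : Fin n => w i.castSucc) = 0 := by
    by_contra hne
    refine (hpos _ hne).ne' ?_
    rw [Finset.sum_comm]
    refine Finset.sum_eq_zero fun j _ => ?_
    rw [← Finset.sum_mul]
    simp_rw [mul_comm (pd _ _ y)]
    rw [hcomp j, zero_mul]
  funext k
  refine Fin.lastCases hlast (fun i => ?_) k
  exact congrFun hinit i

/-- The linear algebra relating the Hessians of `v` and of its partial Legendre transform, given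
the chain rule for its first derivatives. -/
theorem det_hessian_partialLegendre {n : ℕ} {v vs : (Fin (n + 1) → ℝ) → ℝ}
    {y z : Fin (n + 1) → ℝ} {T' : (Fin (n + 1) → ℝ) ≃L[ℝ] (Fin (n + 1) → ℝ)}
    (hT' : ∀ w, T' w = partialLegendreDeriv v y w)
    (hinit : ∀ (j : Fin n) w, fderiv ℝ (pd j.castSucc vs) z (T' w) = w j.castSucc)
    (hlast : ∀ w, fderiv ℝ (pd (Fin.last n) vs) z (T' w)
      = -fderiv ℝ (pd (Fin.last n) v) y w) :
    (Matrix.of fun i j => pd i (pd j v) y).det * (Matrix.of fun i j : Fin n =>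
        pd (Fin.castSucc i) (pd (Fin.castSucc j) vs) z).det
      = -pd (Fin.last n) (pd (Fin.last n) vs) z := by
  set M := Matrix.of fun i j : Fin n => pd (Fin.castSucc i) (pd (Fin.castSucc j) vs) z with hM
  set A := Matrix.of fun i j : Fin n => pd (Fin.castSucc i) (pd (Fin.castSucc j) v) y with hA
  have hAM : A * M = 1 := by
    ext k j
    have h := hinit j (Pi.single k.castSucc 1)
    rw [ContinuousLinearMap.apply_eq_sum_single, Fin.sum_univ_castSucc] at h
    simp only [hT', partialLegendreDeriv_castSucc, partialLegendreDeriv_last] at h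
    rw [Pi.single_eq_of_ne (Fin.castSucc_lt_last k).ne', zero_mul, add_zero] at h
    rw [Matrix.mul_apply, Matrix.one_apply]
    refine h.trans ?_
    simp [Pi.single_apply, eq_comm]
  have hdet : A.det * M.det = 1 := by rw [← Matrix.det_mul, hAM, Matrix.det_one]
  set w := T'.symm (Pi.single (Fin.last n) 1) with hw
  have hTw : T' w = Pi.single (Fin.last n) 1 := T'.apply_symm_apply _
  have hwlast : w (Fin.last n) = 1 := by
    rw [← partialLegendreDeriv_last v y w, ← hT', hTw, Pi.single_eq_same]
  have hH := Matrix.det_eq_of_mulVec_castSucc_eq_zero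
    (Matrix.of fun i j => pd i (pd j v) y).transpose w hwlast (fun i => by
      have h := partialLegendreDeriv_castSucc v y w i
      rw [← hT', hTw, Pi.single_eq_of_ne (Fin.castSucc_lt_last i).ne,
        ContinuousLinearMap.apply_eq_sum_single] at h
      exact h.symm)
  have hA' : (Matrix.of fun i j : Fin n =>
      (Matrix.of fun i j => pd i (pd j v) y).transpose i.castSucc j.castSucc)
      = A.transpose := rfl
  have hsum : ∑ k, w k * (Matrix.of fun i j => pd i (pd j v) y).transpose (Fin.last n) k
      = -pd (Fin.last n) (pd (Fin.last n) vs) z := by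
    have h := hlast w
    rw [hTw, ContinuousLinearMap.apply_eq_sum_single _ w] at h
    change pd (Fin.last n) (pd (Fin.last n) vs) z = _ at h
    rw [h, neg_neg]
    rfl
  rw [Matrix.det_transpose, hA', Matrix.det_transpose, hsum] at hH
  rw [hH, mul_assoc, hdet, mul_one]

theorem hasFDerivAt_partialLegendre {n : ℕ} {v : (Fin (n + 1) → ℝ) → ℝ}
    {y : Fin (n + 1) → ℝ} (hv : ContDiffAt ℝ (⊤ : ℕ∞) v y) :
    HasFDerivAt
      (fun x => (∑ i : Fin n, x (Fin.castSucc i) * pd (Fin.castSucc i) v x) - v x)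
      ((∑ i : Fin n, (y i.castSucc • fderiv ℝ (pd (Fin.castSucc i) v) y
        + pd (Fin.castSucc i) v y • ContinuousLinearMap.proj i.castSucc)) - fderiv ℝ v y) y := by
  refine HasFDerivAt.sub (HasFDerivAt.fun_sum fun i _ => ?_)
    (hv.differentiableAt (by simp)).hasFDerivAt
  exact (hasFDerivAt_apply i.castSucc y).mul
    ((hv.pd i.castSucc).differentiableAt (by simp)).hasFDerivAt

theorem pd_comp_snoc_zero {n : ℕ} {v : (Fin (n + 1) → ℝ) → ℝ} {φ : (Fin n → ℝ) → ℝ}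
    {x : Fin n → ℝ} (hv : DifferentiableAt ℝ v (Fin.snoc x 0 : Fin (n + 1) → ℝ))
    (hφ : ∀ᶠ x' in nhds x, v (Fin.snoc x' 0) = φ x') (i : Fin n) :
    pd i φ x = pd i.castSucc v (Fin.snoc x 0) := by
  let S : (Fin n → ℝ) →L[ℝ] (Fin (n + 1) → ℝ) := ContinuousLinearMap.pi
    (Fin.snoc (α := fun _ => (Fin n → ℝ) →L[ℝ] ℝ) (fun i => ContinuousLinearMap.proj i) 0)
  have hS : ∀ x', S x' = Fin.snoc x' 0 := by
    intro x'
    funext k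
    refine Fin.lastCases ?_ (fun j => ?_) k <;> simp [S]
  have hd : HasFDerivAt φ ((fderiv ℝ v (Fin.snoc x 0)).comp S) x := by
    rw [← hS] at hv ⊢
    refine (hv.hasFDerivAt.comp x S.hasFDerivAt).congr_of_eventuallyEq ?_
    filter_upwards [hφ] with x' hx'
    rw [← hx', Function.comp_apply, hS]
  have hSi : S (Pi.single i 1) = Pi.single i.castSucc 1 := by
    rw [hS]
    funext k
    refine Fin.lastCases ?_ (fun j => ?_) k
    · simp [(Fin.castSucc_lt_last i).ne']
    · simp [Pi.single_apply]
  simp only [pd]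
  rw [hd.fderiv, ContinuousLinearMap.comp_apply, hSi]

/-- the partial Legendre transform of a solution of the hodograph
equation `det D²v = yₙ^m (∂ₙv)^{(n+1)+2}` in `B_δ⁺`, `v(y',0) = φ(y')`, with `D²_{y'}v > 0`
and `T : y ↦ (∇_{y'}v(y), yₙ)` a diffeomorphism onto `Σ⁺ = T(B_δ⁺)`, satisfies
`zₙ^m (−∂ₙv*)^{(n+1)+2} det D²_{z'}v* + ∂ₙ²v* = 0` in `Σ⁺`, with `v* = φ*` (the Legendre
transform of `φ`) on `∂Σ⁺ ∩ {zₙ = 0}`.  (Ambient dimension is `n+1`, so the paper's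
exponent `n+2` reads `n+3` here.) -/
theorem partial_legendre_equation (n m : ℕ) (hn : 1 ≤ n) (hm : 1 ≤ m)
    (δ : ℝ) (hδ : 0 < δ)
    (v : (Fin (n+1) → ℝ) → ℝ)
    (hvsm : ContDiffOn ℝ (⊤:ℕ∞) v (Metric.ball (0 : Fin (n+1) → ℝ) δ))
    (heq : ∀ y ∈ Metric.ball (0 : Fin (n+1) → ℝ) δ, 0 < y (Fin.last n) →
        (Matrix.of fun i j => pd i (pd j v) y).det
          = (y (Fin.last n)) ^ m * (pd (Fin.last n) v y) ^ (n+3))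
    (φ : (Fin n → ℝ) → ℝ)
    (hbc : ∀ y' ∈ Metric.ball (0 : Fin n → ℝ) δ, v (Fin.snoc y' 0) = φ y')
    (hposdef : ∀ y ∈ Metric.ball (0 : Fin (n+1) → ℝ) δ, ∀ ξ : Fin n → ℝ, ξ ≠ 0 →
        0 < ∑ i : Fin n, ∑ j : Fin n,
              pd (Fin.castSucc i) (pd (Fin.castSucc j) v) y * ξ i * ξ j)
    -- the partial Legendre transformation `T` and its image `Σ⁺`:
    (T : (Fin (n+1) → ℝ) → (Fin (n+1) → ℝ))
    (hT : ∀ y, T y = Fin.snoc (fun i => pd (Fin.castSucc i) v y) (y (Fin.last n)))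
    (hTinj : Set.InjOn T (Metric.ball (0 : Fin (n+1) → ℝ) δ ∩ {y | 0 < y (Fin.last n)}))
    (hTopen : IsOpen (T '' (Metric.ball (0 : Fin (n+1) → ℝ) δ ∩ {y | 0 < y (Fin.last n)})))
    -- the partial Legendre transform `v*`:
    (vs : (Fin (n+1) → ℝ) → ℝ)
    (hvs : ∀ y ∈ Metric.ball (0 : Fin (n+1) → ℝ) δ, 0 ≤ y (Fin.last n) →
        vs (T y) = (∑ i : Fin n, y (Fin.castSucc i) * pd (Fin.castSucc i) v y) - v y) :
    (∀ z ∈ T '' (Metric.ball (0 : Fin (n+1) → ℝ) δ ∩ {y | 0 < y (Fin.last n)}),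
        (z (Fin.last n)) ^ m * (-(pd (Fin.last n) vs z)) ^ (n+3) *
            (Matrix.of fun i j : Fin n =>
              pd (Fin.castSucc i) (pd (Fin.castSucc j) vs) z).det
          + pd (Fin.last n) (pd (Fin.last n) vs) z = 0)
    ∧ ∀ y' ∈ Metric.ball (0 : Fin n → ℝ) δ,
        vs (Fin.snoc (fun i => pd i φ y') 0)
          = (∑ i : Fin n, y' i * pd i φ y') - φ y' := by
  have hU : IsOpen (Metric.ball (0 : Fin (n+1) → ℝ) δ ∩ {y | 0 < y (Fin.last n)}) :=
    Metric.isOpen_ball.inter (isOpen_lt continuous_const (continuous_apply _))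
  have hsm : ∀ y ∈ Metric.ball (0 : Fin (n+1) → ℝ) δ, ContDiffAt ℝ (⊤ : ℕ∞) v y :=
    fun y hy => hvsm.contDiffAt (Metric.isOpen_ball.mem_nhds hy)
  constructor
  · have key : ∀ y ∈ Metric.ball (0 : Fin (n+1) → ℝ) δ, ∃ T' : (Fin (n+1) → ℝ) ≃L[ℝ] _,
        (∀ w, T' w = partialLegendreDeriv v y w) ∧
        HasStrictFDerivAt T (T' : (Fin (n+1) → ℝ) →L[ℝ] _) y := by
      intro y hy
      let T' := (LinearEquiv.ofInjectiveEndo (partialLegendreDeriv v y).toLinearMap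
        (partialLegendreDeriv_injective (hposdef y hy))).toContinuousLinearEquiv
      refine ⟨T', fun w => rfl, ?_⟩
      have h : (T' : (Fin (n+1) → ℝ) →L[ℝ] _) = partialLegendreDeriv v y := by
        ext1 w
        rfl
      rw [h]
      exact hasStrictFDerivAt_partialLegendre (hsm y hy) hT
    have hfirst : ∀ y ∈ Metric.ball (0 : Fin (n+1) → ℝ) δ ∩ {y | 0 < y (Fin.last n)},
        (∀ j : Fin n, pd j.castSucc vs (T y) = y j.castSucc) ∧
        pd (Fin.last n) vs (T y) = -pd (Fin.last n) v y := by
      intro y hy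
      obtain ⟨T', hT', hTd⟩ := key y hy.1
      have hd := hTd.hasFDerivAt_of_comp_eventuallyEq (h := vs)
        (hasFDerivAt_partialLegendre (hsm y hy.1))
        (by filter_upwards [hU.mem_nhds hy] with x hx using hvs x hx.1 (le_of_lt hx.2))
      have hformula : ∀ u, fderiv ℝ vs (T y) u
          = (∑ i : Fin n, y i.castSucc * u i.castSucc)
            - pd (Fin.last n) v y * u (Fin.last n) := by
        intro u
        obtain ⟨w, rfl⟩ := T'.surjective u
        rw [hd.fderiv, ContinuousLinearMap.comp_apply, ContinuousLinearEquiv.coe_coe,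
          T'.symm_apply_apply, hT', partialLegendreDeriv_last]
        simp only [partialLegendreDeriv_castSucc]
        rw [_root_.sub_apply,
          ContinuousLinearMap.apply_eq_sum_single (fderiv ℝ v y) w, Fin.sum_univ_castSucc]
        simp only [_root_.sum_apply, _root_.add_apply,
          _root_.smul_apply, ContinuousLinearMap.proj_apply, smul_eq_mul,
          Finset.sum_add_distrib, pd]
        simp only [mul_comm (w _)]
        ring
      refine ⟨fun j => ?_, ?_⟩
      · rw [pd, hformula, Pi.single_eq_of_ne (Fin.castSucc_lt_last j).ne']
        simp [Pi.single_apply]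
      · rw [pd, hformula]
        simp
    rintro _ ⟨y, hy, rfl⟩
    obtain ⟨T', hT', hTd⟩ := key y hy.1
    have hdet := det_hessian_partialLegendre (vs := vs) (z := T y) hT'
      (fun j w => by
        have hd := hTd.hasFDerivAt_of_comp_eventuallyEq (h := pd j.castSucc vs)
          (hasFDerivAt_apply (𝕜 := ℝ) j.castSucc y)
          (by filter_upwards [hU.mem_nhds hy] with x hx using (hfirst x hx).1 j)
        rw [hd.fderiv]
        simp)
      (fun w => by
        have hd := hTd.hasFDerivAt_of_comp_eventuallyEq (h := pd (Fin.last n) vs)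
          (((hsm y hy.1).pd (Fin.last n)).differentiableAt (by simp)).hasFDerivAt.neg
          (by filter_upwards [hU.mem_nhds hy] with x hx using (hfirst x hx).2)
        rw [hd.fderiv]
        simp)
    have hTlast : T y (Fin.last n) = y (Fin.last n) := by rw [hT, Fin.snoc_last]
    rw [hTlast, (hfirst y hy).2, neg_neg, ← heq y hy.1 hy.2, hdet, neg_add_cancel]
  · intro y' hy'
    have hmem : (Fin.snoc y' 0 : Fin (n+1) → ℝ) ∈ Metric.ball (0 : Fin (n+1) → ℝ) δ := by
      rw [mem_ball_zero_iff, pi_norm_lt_iff hδ] at hy' ⊢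
      intro k
      refine Fin.lastCases ?_ (fun j => ?_) k
      · simpa using hδ
      · simpa using hy' j
    have hpd : ∀ i, pd i φ y' = pd i.castSucc v (Fin.snoc y' 0) :=
      pd_comp_snoc_zero ((hsm _ hmem).differentiableAt (by simp))
        (by filter_upwards [Metric.isOpen_ball.mem_nhds hy'] with x hx using hbc x hx)
    have h := hvs _ hmem (by simp)
    rw [hT, hbc y' hy'] at h
    simpa [hpd] using h
end
end
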